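/- Let (R, m) be a Noetherian local ring, and suppose x₁, …, xₙ ∈ m \ m² are elements with n = ms(R) such that m² ⊆ (x₁, …, xₙ). Then for every integer 1 ≤ t ≤ n, one has ms(R/(x₁, …, x_t)) = ms(R) − t. -/

import Mathlib

open IsLocalRing

/-- The minimal number of generators of an ideal. -/
noncomputable def mu {R : Type*} [CommRing R] (I : Ideal R) : ℕ :=
  sInf {n : ℕ | ∃ s : Finset R, s.card = n ∧ Ideal.span (s : Set R) = I}

/-- `ms R = min {μ(I) : m² ⊆ I ⊆ m}`. -/
noncomputable def ms (R : Type*) [CommRing R] [IsLocalRing R] : ℕ :=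
  sInf {n : ℕ | ∃ I : Ideal R,
    (maximalIdeal R) ^ 2 ≤ I ∧ I ≤ maximalIdeal R ∧ mu I = n}

theorem mu_le_card {R : Type*} [CommRing R] (s : Finset R) :
    mu (Ideal.span (s : Set R)) ≤ s.card :=
  Nat.sInf_le ⟨s, rfl, rfl⟩

theorem exists_mu {R : Type*} [CommRing R] [IsNoetherianRing R] (I : Ideal R) :
    ∃ s : Finset R, s.card = mu I ∧ Ideal.span (s : Set R) = I := by
  have hne : {n : ℕ | ∃ s : Finset R, s.card = n ∧ Ideal.span (s : Set R) = I}.Nonempty := by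
    obtain ⟨s, hs⟩ := IsNoetherian.noetherian I
    exact ⟨s.card, s, rfl, hs⟩
  exact Nat.sInf_mem hne

theorem ms_le_card {R : Type*} [CommRing R] [IsLocalRing R] (s : Finset R)
    (h1 : (maximalIdeal R) ^ 2 ≤ Ideal.span (s : Set R))
    (h2 : Ideal.span (s : Set R) ≤ maximalIdeal R) : ms R ≤ s.card :=
  le_trans (Nat.sInf_le ⟨_, h1, h2, rfl⟩) (mu_le_card s)

theorem exists_ms (R : Type*) [CommRing R] [IsLocalRing R] [IsNoetherianRing R] :
    ∃ s : Finset R, s.card = ms R ∧ (maximalIdeal R) ^ 2 ≤ Ideal.span (s : Set R) ∧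
      Ideal.span (s : Set R) ≤ maximalIdeal R := by
  have hne : {n : ℕ | ∃ I : Ideal R,
      (maximalIdeal R) ^ 2 ≤ I ∧ I ≤ maximalIdeal R ∧ mu I = n}.Nonempty :=
    ⟨_, maximalIdeal R, Ideal.pow_le_self two_ne_zero, le_rfl, rfl⟩
  obtain ⟨I, h1, h2, h3⟩ := Nat.sInf_mem hne
  obtain ⟨s, hs, rfl⟩ := exists_mu I
  exact ⟨s, hs.trans h3, h1, h2⟩

theorem ms_quot {R S : Type*} [CommRing R] [IsLocalRing R] [IsNoetherianRing R]
    [CommRing S] [IsLocalRing S] (f : R →+* S) (hf : Function.Surjective f)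
    {n : ℕ} (x : Fin n → R) (hx : ∀ i, x i ∈ maximalIdeal R) (hn : ms R = n)
    (hwit : (maximalIdeal R) ^ 2 ≤ Ideal.span (Set.range x)) (t : ℕ) (ht2 : t ≤ n)
    (hker : RingHom.ker f = Ideal.span (x '' {i : Fin n | (i : ℕ) < t})) :
    ms S = ms R - t := by
  classical
  have : IsNoetherianRing S := isNoetherianRing_of_surjective R S f hf
  have hc : (maximalIdeal S).comap f = maximalIdeal R :=
    IsLocalRing.eq_maximalIdeal (Ideal.comap_isMaximal_of_surjective f hf)
  have hm : (maximalIdeal R).map f = maximalIdeal S := by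
    rw [← hc, Ideal.map_comap_of_surjective f hf]
  have hcard : (Finset.univ.filter (fun i : Fin n => (i : ℕ) < t)).card = t := by
    rw [Fin.card_filter_val_lt]; omega
  have hcard2 : (Finset.univ.filter (fun i : Fin n => ¬ (i : ℕ) < t)).card = n - t := by
    have := Finset.card_filter_add_card_filter_not (s := (Finset.univ : Finset (Fin n)))
      (fun i : Fin n => (i : ℕ) < t)
    simp only [Finset.card_univ, Fintype.card_fin] at this
    omega
  have hzero : ∀ i : Fin n, (i : ℕ) < t → f (x i) = 0 := by
    intro i hi
    rw [← RingHom.mem_ker, hker]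
    exact Ideal.subset_span ⟨i, hi, rfl⟩
  rw [hn]
  apply le_antisymm
  · let s := (Finset.univ.filter (fun i : Fin n => ¬ (i : ℕ) < t)).image (fun i => f (x i))
    have hs : s.card ≤ n - t := hcard2 ▸ Finset.card_image_le
    refine le_trans (ms_le_card s ?_ ?_) hs
    · rw [← hm, ← Ideal.map_pow]
      refine (Ideal.map_mono hwit).trans ?_
      rw [Ideal.map_span, Ideal.span_le]
      rintro _ ⟨_, ⟨i, rfl⟩, rfl⟩
      by_cases hi : (i : ℕ) < t
      · rw [hzero i hi]; exact Ideal.zero_mem _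
      · apply Ideal.subset_span
        simp only [s, Finset.coe_image]
        exact ⟨i, by simpa using hi, rfl⟩
    · rw [Ideal.span_le]
      intro y hy
      simp only [s, Finset.coe_image] at hy
      obtain ⟨i, -, rfl⟩ := hy
      rw [← hm]
      exact Ideal.mem_map_of_mem f (hx i)
  · obtain ⟨s, hs, h1, h2⟩ := exists_ms S
    let g := Function.surjInv hf
    have hg : ∀ y, f (g y) = y := Function.surjInv_eq hf
    let u := s.image g ∪ (Finset.univ.filter (fun i : Fin n => (i : ℕ) < t)).image x
    have hu : u.card ≤ ms S + t := by
      refine (Finset.card_union_le _ _).trans (add_le_add ?_ ?_)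
      · exact hs ▸ Finset.card_image_le
      · exact Finset.card_image_le.trans hcard.le
    have hspan : Ideal.span (u : Set R) = (Ideal.span (s : Set S)).comap f := by
      have e1 : Ideal.span (s : Set S) = (Ideal.span (g '' (s : Set S))).map f := by
        rw [Ideal.map_span, Set.image_image]
        simp [hg]
      have e2 : (u : Set R) = g '' (s : Set S) ∪ x '' {i : Fin n | (i : ℕ) < t} := by
        simp [u]
      rw [e1, Ideal.comap_map_of_surjective f hf, e2, Ideal.span_union, ← hker]
      rfl
    have : ms R ≤ u.card := by
      apply ms_le_card u
      · rw [hspan, ← Ideal.map_le_iff_le_comap, Ideal.map_pow, hm]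
        exact h1
      · rw [hspan, ← hc]
        exact Ideal.comap_mono h2
    omega

/-- Let `(R, m)` be a Noetherian local ring and let `x₁, …, xₙ ∈ m \ m²` with
`n = ms(R)` be such that `m² ⊆ (x₁, …, xₙ)`.  Then for every `1 ≤ t ≤ n` one has
`ms(R/(x₁, …, x_t)) = ms(R) − t`. -/
theorem stmt6 {R : Type*} [CommRing R] [IsLocalRing R] [IsNoetherianRing R]
    {n : ℕ} (x : Fin n → R)
    (hx : ∀ i, x i ∈ maximalIdeal R ∧ x i ∉ (maximalIdeal R) ^ 2)
    (hn : ms R = n)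
    (hwit : (maximalIdeal R) ^ 2 ≤ Ideal.span (Set.range x))
    (t : ℕ) (ht1 : 1 ≤ t) (ht2 : t ≤ n) :
    letI : Nontrivial (R ⧸ Ideal.span (x '' {i : Fin n | (i : ℕ) < t})) :=
      Ideal.Quotient.nontrivial_iff.mpr (fun h =>
        (Ideal.IsMaximal.ne_top (maximalIdeal.isMaximal R))
          (top_le_iff.mp (h ▸ Ideal.span_le.mpr (by
            rintro y ⟨i, -, rfl⟩
            exact (hx i).1))))
    letI : IsLocalRing (R ⧸ Ideal.span (x '' {i : Fin n | (i : ℕ) < t})) :=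
      IsLocalRing.of_surjective' (Ideal.Quotient.mk _) Ideal.Quotient.mk_surjective
    ms (R ⧸ Ideal.span (x '' {i : Fin n | (i : ℕ) < t})) = ms R - t := by
  have key : ∀ i2 : IsLocalRing (R ⧸ Ideal.span (x '' {i : Fin n | (i : ℕ) < t})),
      @ms _ _ i2 = ms R - t := fun i2 =>
    ms_quot (Ideal.Quotient.mk _) Ideal.Quotient.mk_surjective x
      (fun i => (hx i).1) hn hwit t ht2 Ideal.mk_ker
  exact key _
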